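/- arXiv:2603.28598 — 2 statements merged into one kernel-verified Lean document; each statement's English description precedes it below -/
import Mathlib

section
/- Suppose additionally that there exists ε > 0 with q_{i,n} ≥ ε for all i ∈ {0,…,s−1} and all n ≥ 1. Let V_n ⊆ {0,…,s−1} be nonempty sets such that V_n ≠ {0,…,s−1} for infinitely many n. Then the Cantor-type set C[Q*_s; V] = {Δ(α) : α a digit sequence with α_n ∈ V_n for all n} has Lebesgue measure zero. -/
open Filter Topology MeasureTheory Set

set_option linter.unusedVariables false

/-- β_{k,n} = Σ_{i<k} q_{i,n}. -/
noncomputable def qbeta (s : ℕ) (q : Fin s → ℕ → ℝ) (k : Fin s) (n : ℕ) : ℝ :=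
  ∑ i : Fin s, if i < k then q i n else 0

/-- Δ(α) = β_{α_1,1} + Σ_{n≥2} β_{α_n,n} Π_{j<n} q_{α_j,j}, with positions indexed from 0. -/
noncomputable def Delta (s : ℕ) (q : Fin s → ℕ → ℝ) (α : ℕ → Fin s) : ℝ :=
  ∑' n : ℕ, qbeta s q (α n) n * ∏ j ∈ Finset.range n, q (α j) j

/-- the digit |a − b|. -/
def adiff {s : ℕ} (a b : Fin s) : Fin s :=
  ⟨a.1 - b.1 + (b.1 - a.1), by have ha := a.2; have hb := b.2; omega⟩

open Classical in
/-- Total weight at position `n` of the admissible digits. -/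
noncomputable def digitWeight {s : ℕ} (q : Fin s → ℕ → ℝ) (V : ℕ → Set (Fin s)) (n : ℕ) : ℝ :=
  ∑ i ∈ Finset.univ.filter (· ∈ V n), q i n

/-- The Cantor-type set of all `Delta s q α` with `α n ∈ V n` for all `n`. -/
def cantorSet_q {s : ℕ} (q : Fin s → ℕ → ℝ) (V : ℕ → Set (Fin s)) : Set ℝ :=
  {x : ℝ | ∃ α : ℕ → Fin s, (∀ n, α n ∈ V n) ∧ x = Delta s q α}

section

variable {s : ℕ} {q : Fin s → ℕ → ℝ}

lemma qbeta_nonneg (hq0 : ∀ i n, 0 < q i n) (k : Fin s) (n : ℕ) : 0 ≤ qbeta s q k n :=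
  Finset.sum_nonneg fun i _ => by split_ifs <;> simp [(hq0 i n).le]

lemma qbeta_add_le_one (hq0 : ∀ i n, 0 < q i n) (hqsum : ∀ n, ∑ i : Fin s, q i n = 1)
    (k : Fin s) (n : ℕ) : qbeta s q k n + q k n ≤ 1 := by
  have h : q k n = ∑ i : Fin s, if i = k then q i n else 0 := by simp
  rw [h, qbeta, ← Finset.sum_add_distrib, ← hqsum n]
  refine Finset.sum_le_sum fun i _ => ?_
  have := (hq0 i n).le
  by_cases h1 : i < k
  · simp [h1, h1.ne]
  · by_cases h2 : i = k <;> simp [h1, h2, this]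

lemma delta_term_nonneg (hq0 : ∀ i n, 0 < q i n) (α : ℕ → Fin s) (n : ℕ) :
    0 ≤ qbeta s q (α n) n * ∏ j ∈ Finset.range n, q (α j) j :=
  mul_nonneg (qbeta_nonneg hq0 _ _) (Finset.prod_nonneg fun j _ => (hq0 _ j).le)

lemma delta_partial_sum_le_one (hq0 : ∀ i n, 0 < q i n) (hqsum : ∀ n, ∑ i : Fin s, q i n = 1)
    (α : ℕ → Fin s) (N : ℕ) :
    ∑ n ∈ Finset.range N, qbeta s q (α n) n * ∏ j ∈ Finset.range n, q (α j) j ≤ 1 := by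
  suffices h : ∑ n ∈ Finset.range N, qbeta s q (α n) n * ∏ j ∈ Finset.range n, q (α j) j +
      ∏ j ∈ Finset.range N, q (α j) j ≤ 1 by
    have : 0 ≤ ∏ j ∈ Finset.range N, q (α j) j := Finset.prod_nonneg fun j _ => (hq0 _ j).le
    linarith
  induction N with
  | zero => simp
  | succ N ih =>
    rw [Finset.sum_range_succ, Finset.prod_range_succ]
    have hp : 0 ≤ ∏ j ∈ Finset.range N, q (α j) j := Finset.prod_nonneg fun j _ => (hq0 _ j).le
    nlinarith [mul_le_mul_of_nonneg_right (qbeta_add_le_one hq0 hqsum (α N) N) hp]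

lemma delta_summable (hq0 : ∀ i n, 0 < q i n) (hqsum : ∀ n, ∑ i : Fin s, q i n = 1)
    (α : ℕ → Fin s) :
    Summable fun n => qbeta s q (α n) n * ∏ j ∈ Finset.range n, q (α j) j :=
  summable_of_sum_range_le (delta_term_nonneg hq0 α) (delta_partial_sum_le_one hq0 hqsum α)

lemma delta_mem_Icc (hq0 : ∀ i n, 0 < q i n) (hqsum : ∀ n, ∑ i : Fin s, q i n = 1)
    (α : ℕ → Fin s) : Delta s q α ∈ Icc (0 : ℝ) 1 :=
  ⟨tsum_nonneg (delta_term_nonneg hq0 α),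
    Real.tsum_le_of_sum_range_le (delta_term_nonneg hq0 α) (delta_partial_sum_le_one hq0 hqsum α)⟩

lemma delta_eq_shift (hq0 : ∀ i n, 0 < q i n) (hqsum : ∀ n, ∑ i : Fin s, q i n = 1)
    (α : ℕ → Fin s) :
    Delta s q α =
      qbeta s q (α 0) 0 + q (α 0) 0 * Delta s (fun i n => q i (n + 1)) (fun n => α (n + 1)) := by
  rw [Delta, (delta_summable hq0 hqsum α).tsum_eq_zero_add, Delta, ← tsum_mul_left]
  congr 1
  · simp
  · refine tsum_congr fun n => ?_
    rw [Finset.prod_range_succ']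
    simp only [qbeta]
    ring

lemma digitWeight_nonneg (hq0 : ∀ i n, 0 < q i n) (V : ℕ → Set (Fin s)) (n : ℕ) :
    0 ≤ digitWeight q V n :=
  Finset.sum_nonneg fun i _ => (hq0 i n).le

open scoped Pointwise in
lemma volume_cantorSet_q_le (N : ℕ) (hq0 : ∀ i n, 0 < q i n)
    (hqsum : ∀ n, ∑ i : Fin s, q i n = 1) (V : ℕ → Set (Fin s)) :
    volume (cantorSet_q q V) ≤ ENNReal.ofReal (∏ n ∈ Finset.range N, digitWeight q V n) := by
  classical
  induction N generalizing q V with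
  | zero =>
    have h : cantorSet_q q V ⊆ Icc (0 : ℝ) 1 := by
      rintro x ⟨α, -, rfl⟩
      exact delta_mem_Icc hq0 hqsum α
    simpa using measure_mono (μ := volume) h
  | succ N ih =>
    set q' : Fin s → ℕ → ℝ := fun i n => q i (n + 1)
    set V' : ℕ → Set (Fin s) := fun n => V (n + 1)
    have hsub : cantorSet_q q V ⊆ ⋃ i ∈ Finset.univ.filter (· ∈ V 0),
        (qbeta s q i 0 + ·) '' (q i 0 • cantorSet_q q' V') := by
      rintro x ⟨α, hα, rfl⟩
      refine mem_iUnion₂.2 ⟨α 0, by simpa using hα 0, _,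
        smul_mem_smul_set ⟨fun n => α (n + 1), fun n => hα _, rfl⟩, ?_⟩
      exact (delta_eq_shift hq0 hqsum α).symm
    have hvol : ∀ i, volume ((qbeta s q i 0 + ·) '' (q i 0 • cantorSet_q q' V')) =
        ENNReal.ofReal (q i 0) * volume (cantorSet_q q' V') := by
      intro i
      rw [image_add_left, measure_preimage_add, Measure.addHaar_smul]
      simp [abs_of_pos (hq0 i 0)]
    calc volume (cantorSet_q q V)
        ≤ ∑ i ∈ Finset.univ.filter (· ∈ V 0),
            volume ((qbeta s q i 0 + ·) '' (q i 0 • cantorSet_q q' V')) :=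
          (measure_mono hsub).trans (measure_biUnion_finset_le _ _)
      _ = ENNReal.ofReal (digitWeight q V 0) * volume (cantorSet_q q' V') := by
          simp only [hvol]
          rw [← Finset.sum_mul, digitWeight,
            ENNReal.ofReal_sum_of_nonneg fun i _ => (hq0 i 0).le]
      _ ≤ ENNReal.ofReal (digitWeight q V 0) *
            ENNReal.ofReal (∏ n ∈ Finset.range N, digitWeight q' V' n) := by
          gcongr
          exact ih (fun i n => hq0 i (n + 1)) (fun n => hqsum (n + 1)) V'
      _ = ENNReal.ofReal (∏ n ∈ Finset.range (N + 1), digitWeight q V n) := by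
          rw [← ENNReal.ofReal_mul (digitWeight_nonneg hq0 V 0),
            Finset.prod_range_succ', mul_comm]
          rfl

lemma digitWeight_le_one (hq0 : ∀ i n, 0 < q i n) (hqsum : ∀ n, ∑ i : Fin s, q i n = 1)
    (V : ℕ → Set (Fin s)) (n : ℕ) : digitWeight q V n ≤ 1 := by
  classical
  rw [← hqsum n]
  exact Finset.sum_le_sum_of_subset_of_nonneg (Finset.filter_subset _ _)
    fun i _ _ => (hq0 i n).le

lemma digitWeight_le_one_sub (hq0 : ∀ i n, 0 < q i n) (hqsum : ∀ n, ∑ i : Fin s, q i n = 1)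
    {ε : ℝ} (hqε : ∀ i n, ε ≤ q i n) (V : ℕ → Set (Fin s)) {n : ℕ} (hn : V n ≠ univ) :
    digitWeight q V n ≤ 1 - ε := by
  classical
  obtain ⟨k, hk⟩ := (ne_univ_iff_exists_notMem _).1 hn
  have h : digitWeight q V n ≤ ∑ i ∈ Finset.univ.erase k, q i n :=
    Finset.sum_le_sum_of_subset_of_nonneg
      (fun i hi => by
        have hi' : i ∈ V n := by simpa using hi
        exact Finset.mem_erase.2 ⟨fun h => hk (h ▸ hi'), Finset.mem_univ i⟩)
      fun i _ _ => (hq0 i n).le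
  have h' := Finset.sum_erase_add Finset.univ (fun i => q i n) (Finset.mem_univ k)
  rw [hqsum n] at h'
  linarith [hqε k n]

end

lemma exists_prod_range_le_pow {c : ℕ → ℝ} {r : ℝ} (hc0 : ∀ n, 0 ≤ c n) (hc1 : ∀ n, c n ≤ 1)
    (hr : 0 ≤ r) (hc : {n | c n ≤ r}.Infinite) (k : ℕ) :
    ∃ N, ∏ n ∈ Finset.range N, c n ≤ r ^ k := by
  induction k with
  | zero => exact ⟨0, by simp⟩
  | succ k ih =>
    obtain ⟨N, hN⟩ := ih
    obtain ⟨m, hm, hNm⟩ := hc.exists_gt N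
    refine ⟨m + 1, ?_⟩
    rw [Finset.prod_range_succ, pow_succ]
    have hmono : ∏ n ∈ Finset.range m, c n ≤ ∏ n ∈ Finset.range N, c n :=
      Finset.prod_anti_set_of_le_one hc0 hc1 (Finset.range_mono hNm.le)
    exact mul_le_mul (hmono.trans hN) hm (hc0 m) (pow_nonneg hr k)

/-- if the q_{i,n} are uniformly bounded below by ε > 0 and V_n ≠ A for
infinitely many n, then the Cantor-type set C[Q*_s; V] has Lebesgue measure zero. -/
theorem stmt5 (s : ℕ) (hs : 2 ≤ s) (q : Fin s → ℕ → ℝ)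
    (hq0 : ∀ i n, 0 < q i n) (hq1 : ∀ i n, q i n < 1)
    (hqsum : ∀ n, ∑ i : Fin s, q i n = 1)
    (hqprod : Filter.Tendsto (fun N => ∏ n ∈ Finset.range N, ⨆ i : Fin s, q i n)
      Filter.atTop (nhds 0))
    (ε : ℝ) (hε : 0 < ε) (hqε : ∀ i n, ε ≤ q i n)
    (V : ℕ → Set (Fin s)) (hV : ∀ n, (V n).Nonempty)
    (hVinf : {n : ℕ | V n ≠ Set.univ}.Infinite) :
    MeasureTheory.volume
      {x : ℝ | ∃ α : ℕ → Fin s, (∀ n, α n ∈ V n) ∧ x = Delta s q α} = 0 := by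
  have hr0 : 0 ≤ 1 - ε := by
    linarith [hqε ⟨0, by omega⟩ 0, hq1 ⟨0, by omega⟩ 0]
  have hbound : ∀ k : ℕ, volume (cantorSet_q q V) ≤ ENNReal.ofReal ((1 - ε) ^ k) := by
    intro k
    obtain ⟨N, hN⟩ := exists_prod_range_le_pow (digitWeight_nonneg hq0 V)
      (digitWeight_le_one hq0 hqsum V) hr0
      (hVinf.mono fun n hn => digitWeight_le_one_sub hq0 hqsum hqε V hn) k
    exact (volume_cantorSet_q_le N hq0 hqsum V).trans (ENNReal.ofReal_le_ofReal hN)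
  have hlim : Tendsto (fun k : ℕ => ENNReal.ofReal ((1 - ε) ^ k)) atTop (𝓝 0) := by
    simpa using ENNReal.tendsto_ofReal
      (tendsto_pow_atTop_nhds_zero_of_lt_one hr0 (by linarith))
  exact le_antisymm (ge_of_tendsto' hlim hbound) zero_le
end

section
/- Assume s > 2. Let y_0 = Δ(b) be a Q*_s-unary number with digit sequence b = (b_n). Suppose that for every n, the equation |a_n − α_n| = b_n is solvable for a digit α_n ∈ {0,…,s−1} (i.e., a_n ≥ b_n or a_n + b_n ≤ s−1), and that the set {n : b_n ≠ 0 and a_n ≥ b_n and a_n + b_n ≤ s−1} is finite. Then the level set L(y_0) = {Δ(α) : α a digit sequence with |a_n − α_n| = b_n for all n} is nonempty and finite. -/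
open Filter Topology MeasureTheory Set

set_option linter.unusedVariables false

/-- Off the places where both solutions of `|a - x| = b` are admissible and distinct,
the solution is unique. -/
theorem adiff_right_unique {s : ℕ} {a b x y : Fin s}
    (h : ¬(b.1 ≠ 0 ∧ b.1 ≤ a.1 ∧ a.1 + b.1 ≤ s - 1))
    (hx : adiff a x = b) (hy : adiff a y = b) : x = y := by
  have hx' := congrArg Fin.val hx
  have hy' := congrArg Fin.val hy
  simp only [adiff] at hx' hy'
  apply Fin.ext
  omega

theorem exists_adiff_eq {s : ℕ} {a b : Fin s} (h : b.1 ≤ a.1 ∨ a.1 + b.1 ≤ s - 1) :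
    ∃ x : Fin s, adiff a x = b := by
  rcases h with h | h
  · exact ⟨⟨a.1 - b.1, by omega⟩, Fin.ext (by simp only [adiff]; omega)⟩
  · exact ⟨⟨a.1 + b.1, by omega⟩, Fin.ext (by simp only [adiff]; omega)⟩

theorem finite_setOf_adiff_eq {s : ℕ} (a b : ℕ → Fin s)
    (hfin : {n : ℕ | (b n).1 ≠ 0 ∧ (b n).1 ≤ (a n).1 ∧ (a n).1 + (b n).1 ≤ s - 1}.Finite) :
    {α : ℕ → Fin s | ∀ n, adiff (a n) (α n) = b n}.Finite := by
  have := hfin.to_subtype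
  refine Set.Finite.of_finite_image (Set.toFinite (Set.image
    (fun (α : ℕ → Fin s) (n : {n : ℕ | (b n).1 ≠ 0 ∧ (b n).1 ≤ (a n).1 ∧
      (a n).1 + (b n).1 ≤ s - 1}) => α n) _)) ?_
  intro α hα γ hγ h
  funext n
  by_cases hn : (b n).1 ≠ 0 ∧ (b n).1 ≤ (a n).1 ∧ (a n).1 + (b n).1 ≤ s - 1
  · exact congrFun h ⟨n, hn⟩
  · exact adiff_right_unique hn (hα n) (hγ n)

/-- s > 2; if |a_n − α_n| = b_n is solvable in digits for every n, and
b_n ≠ 0 with both solutions admissible for only finitely many n, then the level set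
L(y₀) of the unary point y₀ = Δ(b) is nonempty and finite. -/
theorem stmt18 (s : ℕ) (hs : 2 ≤ s) (q : Fin s → ℕ → ℝ)
    (hq0 : ∀ i n, 0 < q i n) (hq1 : ∀ i n, q i n < 1)
    (hqsum : ∀ n, ∑ i : Fin s, q i n = 1)
    (hqprod : Filter.Tendsto (fun N => ∏ n ∈ Finset.range N, ⨆ i : Fin s, q i n)
      Filter.atTop (nhds 0))
    (hs' : 2 < s)
    (a : ℝ) (ha : a ∈ Set.Icc (0 : ℝ) 1) (aseq : ℕ → Fin s)
    (haseq : a = ∑' n : ℕ, (aseq n : ℝ) / (s : ℝ) ^ (n + 1))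
    (b : ℕ → Fin s)
    (hbunary : ∀ γ : ℕ → Fin s, Delta s q γ = Delta s q b → γ = b)
    (hsolv : ∀ n, (b n).1 ≤ (aseq n).1 ∨ (aseq n).1 + (b n).1 ≤ s - 1)
    (hfin : {n : ℕ | (b n).1 ≠ 0 ∧ (b n).1 ≤ (aseq n).1 ∧
        (aseq n).1 + (b n).1 ≤ s - 1}.Finite) :
    {x : ℝ | ∃ α : ℕ → Fin s, (∀ n, adiff (aseq n) (α n) = b n) ∧
        x = Delta s q α}.Nonempty ∧
      {x : ℝ | ∃ α : ℕ → Fin s, (∀ n, adiff (aseq n) (α n) = b n) ∧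
        x = Delta s q α}.Finite := by
  constructor
  · choose α hα using fun n => exists_adiff_eq (hsolv n)
    exact ⟨Delta s q α, α, hα, rfl⟩
  · refine ((finite_setOf_adiff_eq aseq b hfin).image (Delta s q)).subset ?_
    rintro x ⟨α, hα, rfl⟩
    exact ⟨α, hα, rfl⟩
end
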